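/- The homology of the chain complex (Y, ∂), where Y = Z_2[y_0, y_1, ...] and ∂ is the derivation with ∂y_0 = 0 and ∂y_k = y_{k-1}^2 for k ≥ 1, is two-dimensional over Z_2: H(Y) = ker ∂ / im ∂ has basis the classes of 1 and y_0. As a Z_2-algebra, H(Y) ≅ Z_2[t]/(t^2) with t the class of y_0. -/

import Mathlib

open MvPolynomial

/-- `Y = Z_2[y_0, y_1, y_2, ...]`. -/
abbrev Ypoly := MvPolynomial ℕ (ZMod 2)

/-- Largest index occurring in an exponent vector. -/
noncomputable def topIdx (m : ℕ →₀ ℕ) : ℕ := m.support.sup id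

/-- The contracting homotopy. -/
noncomputable def homot : Ypoly →ₗ[ZMod 2] Ypoly :=
  (MvPolynomial.basisMonomials ℕ (ZMod 2)).constr (ZMod 2) (fun m =>
    if 2 ≤ m (topIdx m) then
      monomial (m - Finsupp.single (topIdx m) 2 + Finsupp.single (topIdx m + 1) 1) 1 else 0)

theorem homot_monomial (m : ℕ →₀ ℕ) : homot (monomial m 1) =
    if 2 ≤ m (topIdx m) then
      monomial (m - Finsupp.single (topIdx m) 2 + Finsupp.single (topIdx m + 1) 1) 1 else 0 := by
  have := (MvPolynomial.basisMonomials ℕ (ZMod 2)).constr_basis (ZMod 2) (fun m =>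
    if 2 ≤ m (topIdx m) then
      (monomial (m - Finsupp.single (topIdx m) 2 + Finsupp.single (topIdx m + 1) 1) 1 : Ypoly)
      else 0) m
  rw [coe_basisMonomials] at this
  exact this

theorem topIdx_eq (m : ℕ →₀ ℕ) (N : ℕ) (h : m N ≠ 0) (h2 : ∀ i, N < i → m i = 0) :
    topIdx m = N := by
  apply le_antisymm
  · apply Finset.sup_le
    intro i hi
    by_contra hc
    exact (Finsupp.mem_support_iff.1 hi) (h2 i (not_le.1 hc))
  · exact Finset.le_sup (f := id) (Finsupp.mem_support_iff.2 h)

theorem lin_ext_supported (N : ℕ) (A B : Ypoly →ₗ[ZMod 2] Ypoly)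
    (h : ∀ s : ℕ →₀ ℕ, (∀ i, N < i → s i = 0) → A (monomial s 1) = B (monomial s 1))
    (f : Ypoly) (hf : f ∈ supported (ZMod 2) (Set.Iic N)) : A f = B f := by
  rw [f.as_sum, map_sum, map_sum]
  refine Finset.sum_congr rfl fun s hs => ?_
  have e : monomial s (coeff s f) = (coeff s f) • (monomial s 1 : Ypoly) := by
    rw [smul_monomial, smul_eq_mul, mul_one]
  rw [e, map_smul, map_smul, h s]
  intro i hi
  by_contra hc
  have : i ∈ f.vars := (mem_vars i).2 ⟨s, hs, Finsupp.mem_support_iff.2 hc⟩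
  have := mem_supported.1 hf this
  exact absurd hi (not_lt.2 this)

theorem homot_sq (N : ℕ) (f : Ypoly) (hf : f ∈ supported (ZMod 2) (Set.Iic N)) :
    homot (X N ^ 2 * f) = X (N + 1) * f := by
  have key := lin_ext_supported N (homot ∘ₗ LinearMap.mulLeft (ZMod 2) (X N ^ 2 : Ypoly))
    (LinearMap.mulLeft (ZMod 2) (X (N + 1) : Ypoly))
  simp only [LinearMap.comp_apply, LinearMap.mulLeft_apply] at key
  refine key ?_ f hf
  intro s hs
  rw [X_pow_eq_monomial, X, monomial_mul, monomial_mul, one_mul, homot_monomial,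
    topIdx_eq (Finsupp.single N 2 + s) N (by simp)
      (by intro i hi; simp [hs i hi, Finsupp.single_apply, hi.ne])]
  rw [if_pos (by simp), add_tsub_cancel_left, add_comm]

theorem homot_lin (N : ℕ) (f : Ypoly) (hf : f ∈ supported (ZMod 2) (Set.Iic N)) :
    homot (X (N + 1) * f) = 0 := by
  have key := lin_ext_supported N (homot ∘ₗ LinearMap.mulLeft (ZMod 2) (X (N + 1) : Ypoly)) 0
  simp only [LinearMap.comp_apply, LinearMap.mulLeft_apply, LinearMap.zero_apply] at key
  refine key ?_ f hf
  intro s hs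
  rw [X, monomial_mul, one_mul, homot_monomial,
    topIdx_eq (Finsupp.single (N + 1) 1 + s) (N + 1) (by simp)
      (by intro i hi; simp [hs i (by omega), Finsupp.single_apply, hi.ne])]
  rw [if_neg (by simp [hs (N + 1) (by omega)])]

theorem D_supported (D : Derivation (ZMod 2) Ypoly Ypoly)
    (h0 : D (X 0) = 0) (hs : ∀ k : ℕ, D (X (k + 1)) = (X k) ^ 2) (N : ℕ)
    (f : Ypoly) (hf : f ∈ supported (ZMod 2) (Set.Iic N)) :
    D f ∈ supported (ZMod 2) (Set.Iic N) := by
  have hf' := hf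
  unfold supported at hf'
  induction hf' using Algebra.adjoin_induction with
  | mem x hx =>
    obtain ⟨i, hi, rfl⟩ := hx
    cases i with
    | zero => rw [h0]; exact zero_mem _
    | succ k =>
      rw [hs]
      have hk : k ∈ Set.Iic N := by
        simp at hi ⊢; omega
      have hX : (X k : Ypoly) ∈ supported (ZMod 2) (Set.Iic N) :=
        Algebra.subset_adjoin ⟨k, hk, rfl⟩
      exact pow_mem hX 2
  | algebraMap r => rw [D.map_algebraMap]; exact zero_mem _
  | add x y hx hy h1 h2 => rw [map_add]; exact add_mem (h1 hx) (h2 hy)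
  | mul x y hx hy h1 h2 =>
    rw [D.leibniz]
    exact add_mem (mul_mem hx (h2 hy)) (mul_mem hy (h1 hx))

theorem mono_supported (N : ℕ) (s : ℕ →₀ ℕ) (h : ∀ i, N < i → s i = 0) :
    (monomial s 1 : Ypoly) ∈ supported (ZMod 2) (Set.Iic N) := by
  rw [mem_supported]
  intro i hi
  rw [vars_monomial one_ne_zero] at hi
  by_contra hc
  exact (Finsupp.mem_support_iff.1 hi) (h i (not_le.1 hc))

theorem homotopy_formula (D : Derivation (ZMod 2) Ypoly Ypoly)
    (h0 : D (X 0) = 0) (hs : ∀ k : ℕ, D (X (k + 1)) = (X k) ^ 2) (p : Ypoly) :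
    ∃ a b : ZMod 2, p = C a + b • X 0 + (D (homot p) + homot (D p)) := by
  have hmono : ∀ m : ℕ →₀ ℕ, ∃ a b : ZMod 2, (monomial m 1 : Ypoly) =
      C a + b • X 0 + (D (homot (monomial m 1)) + homot (D (monomial m 1))) := by
    intro m
    by_cases hm : m = 0
    · subst hm
      refine ⟨1, 0, ?_⟩
      rw [homot_monomial]
      have : D (monomial 0 1) = 0 := D.map_algebraMap 1
      simp [this]
    have hne : m.support.Nonempty := by simpa using hm
    obtain ⟨N, hN, hmax⟩ := m.support.exists_max_image id hne
    have hN0 := Finsupp.mem_support_iff.1 hN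
    have htop : ∀ i, N < i → m i = 0 := by
      intro i hi
      by_contra hc
      exact absurd (hmax i (Finsupp.mem_support_iff.2 hc)) (not_le.2 hi)
    by_cases h2 : 2 ≤ m N
    · refine ⟨0, 0, ?_⟩
      obtain ⟨s, rfl⟩ : ∃ s, m = Finsupp.single N 2 + s :=
        ⟨m - Finsupp.single N 2, (add_tsub_cancel_of_le (Finsupp.single_le_iff.2 h2)).symm⟩
      have hss := mono_supported N s (fun i hi => by have := htop i hi; simp at this; exact this.2)
      have e : (monomial (Finsupp.single N 2 + s) 1 : Ypoly) = X N ^ 2 * monomial s 1 := by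
        rw [X_pow_eq_monomial, monomial_mul, one_mul]
      rw [e, homot_sq N _ hss, D.leibniz, D.leibniz, hs, D.leibniz_pow]
      have e2 : (2 : ℕ) • ((X N : Ypoly) ^ (2 - 1) • D (X N)) = (0 : Ypoly) := by
        rw [two_nsmul]; exact CharTwo.add_self_eq_zero _
      rw [e2, smul_zero, add_zero, smul_eq_mul, smul_eq_mul, smul_eq_mul,
        homot_sq N _ (D_supported D h0 hs N _ hss)]
      have := CharTwo.add_self_eq_zero (X (N + 1) * D (monomial s 1) : Ypoly)
      simp only [map_zero, zero_smul]
      linear_combination -this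
    · have h1 : m N = 1 := by omega
      obtain ⟨s, rfl⟩ : ∃ s, m = Finsupp.single N 1 + s :=
        ⟨m - Finsupp.single N 1, (add_tsub_cancel_of_le (Finsupp.single_le_iff.2 h1.ge)).symm⟩
      have hsN : s N = 0 := by simpa using h1
      have hst : ∀ i, N < i → s i = 0 := fun i hi => by
        have := htop i hi; simp at this; exact this.2
      have e : (monomial (Finsupp.single N 1 + s) 1 : Ypoly) = X N * monomial s 1 := by
        rw [X, monomial_mul, one_mul]
      cases N with
      | zero =>
        have : s = 0 := by
          ext i
          rcases Nat.eq_zero_or_pos i with rfl | hi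
          · exact hsN
          · exact hst i hi
        subst this
        refine ⟨0, 1, ?_⟩
        have e3 : homot (monomial (Finsupp.single 0 1 + 0) 1) = 0 := by
          rw [homot_monomial, topIdx_eq _ 0 (by simp) (by intro i hi; exact htop i hi)]
          simp
        rw [e3]
        rw [e]
        simp [h0]
      | succ k =>
        refine ⟨0, 0, ?_⟩
        have hss := mono_supported k s (fun i hi => by
          rcases Nat.eq_or_lt_of_le (Nat.succ_le_of_lt hi) with h | h
          · rw [← h]; exact hsN
          · exact hst i h)
        rw [e, homot_lin k _ hss, D.leibniz, hs, map_add, smul_eq_mul, smul_eq_mul,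
          homot_lin k _ (D_supported D h0 hs k _ hss), mul_comm (monomial s 1) (X k ^ 2),
          homot_sq k _ hss]
        simp
  induction p using MvPolynomial.induction_on' with
  | monomial u a =>
    obtain ⟨x, y, h⟩ := hmono u
    refine ⟨a * x, a * y, ?_⟩
    have e : monomial u a = a • (monomial u 1 : Ypoly) := by
      rw [smul_monomial, smul_eq_mul, mul_one]
    rw [e, D.map_smul, homot.map_smul, D.map_smul, homot.map_smul]
    conv_lhs => rw [h]
    simp only [smul_add, mul_smul, C_mul, smul_eq_C_mul]
  | add p q hp hq =>
    obtain ⟨a, b, h⟩ := hp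
    obtain ⟨a', b', h'⟩ := hq
    refine ⟨a + a', b + b', ?_⟩
    conv_lhs => rw [h, h']
    simp only [map_add, add_smul]
    abel

/-- The augmentation to the dual numbers. -/
noncomputable def augm : Ypoly →ₐ[ZMod 2] DualNumber (ZMod 2) :=
  aeval (fun k => if k = 0 then DualNumber.eps else 0)

theorem augm_D (D : Derivation (ZMod 2) Ypoly Ypoly)
    (h0 : D (X 0) = 0) (hs : ∀ k : ℕ, D (X (k + 1)) = (X k) ^ 2) (q : Ypoly) :
    augm (D q) = 0 := by
  induction q using MvPolynomial.induction_on with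
  | C a =>
    have : D (C a) = 0 := D.map_algebraMap a
    rw [this, map_zero]
  | add p q hp hq => rw [map_add, map_add, hp, hq, add_zero]
  | mul_X p n hp =>
    rw [D.leibniz, map_add, smul_eq_mul, smul_eq_mul, map_mul, map_mul, hp, mul_zero, add_zero]
    cases n with
    | zero => simp [h0]
    | succ k =>
      rw [hs, map_pow]
      by_cases hk : k = 0 <;> simp [augm, hk, pow_two]

theorem augm_lin (a b : ZMod 2) :
    (augm (C a + b • X 0)).fst = a ∧ (augm (C a + b • X 0)).snd = b := by
  have : augm (C a) = algebraMap _ _ a := augm.commutes a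
  rw [map_add, map_smul, this]
  constructor <;> simp [augm, TrivSqZeroExt.algebraMap_eq_inl]

theorem stmt9 (D : Derivation (ZMod 2) Ypoly Ypoly)
    (h0 : D (X 0) = 0)
    (hs : ∀ k : ℕ, D (X (k + 1)) = (X k) ^ 2) :
    (∀ p : Ypoly, D p = 0 →
      ∃! c : ZMod 2 × ZMod 2, ∃ q : Ypoly, p = C c.1 + c.2 • X 0 + D q) ∧
    (∃ q : Ypoly, (X 0 : Ypoly) ^ 2 = D q) := by
  refine ⟨fun p hp => ?_, X 1, (hs 0).symm⟩
  obtain ⟨a, b, h⟩ := homotopy_formula D h0 hs p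
  rw [hp, map_zero, add_zero] at h
  refine ⟨(a, b), ⟨_, h⟩, ?_⟩
  rintro ⟨a', b'⟩ ⟨q, hq⟩
  have e1 := congrArg augm h
  have e2 := congrArg augm hq
  rw [map_add, augm_D D h0 hs, add_zero] at e1 e2
  rw [e1] at e2
  have f1 := congrArg TrivSqZeroExt.fst e2
  have f2 := congrArg TrivSqZeroExt.snd e2
  rw [(augm_lin a b).1, (augm_lin a' b').1] at f1
  rw [(augm_lin a b).2, (augm_lin a' b').2] at f2
  rw [f1, f2]
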